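/- arXiv:0710.1870 — 2 statements merged into one kernel-verified Lean document; each statement's English description precedes it below -/
import Mathlib

section
/- Let G be a graph with n ≥ 3 nodes, with edge weights g_{i,j} and node weights w_i = g_{i,i}, taking values in a set X containing a distinguished element 0. Write P := { {i,j} : 1 ≤ i < j ≤ n } and E := { S ∈ P : g_T ≠ g_S for all T ∈ P \ {S} }. Assume that for every {i,j} ∈ P at least one of the following holds: (i) {i,j} ∈ E; (ii) there exists k ∈ {1,…,n} \ {i,j} such that {i,k} ∈ E and {j,k} ∈ E; (iii) g_{i,j} = 0. Then G is reconstructible from the distribution of subtriangles: every graph G' with n nodes and weights in X satisfying T_{G'} = T_G is isomorphic to G. -/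
/-- Subtriangle of a weighted graph on pairwise distinct nodes `i, j, k`. -/
def subtriangle {n : ℕ} {X : Type*} (g : Sym2 (Fin n) → X) (i j k : Fin n) :
    Multiset (X × X) :=
  {(g s(i, j), g s(k, k)), (g s(i, k), g s(j, j)), (g s(j, k), g s(i, i))}

/-- The distribution of subtriangles of a graph. -/
def triangleDist {n : ℕ} {X : Type*} (g : Sym2 (Fin n) → X) :
    Multiset (Multiset (X × X)) :=
  ((Finset.univ : Finset (Fin n × Fin n × Fin n)).filter
      (fun p => p.1 < p.2.1 ∧ p.2.1 < p.2.2)).val.map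
    (fun p => subtriangle g p.1 p.2.1 p.2.2)

/-- The set `E` of edges (unordered pairs of distinct nodes, i.e. elements of
`P`) whose weight differs from the weight of every other element of `P`. -/
def uniqueEdges {n : ℕ} {X : Type*} (g : Sym2 (Fin n) → X) :
    Set (Sym2 (Fin n)) :=
  {S | ¬ S.IsDiag ∧ ∀ T : Sym2 (Fin n), ¬ T.IsDiag → T ≠ S → g T ≠ g S}

/-- Two graphs are isomorphic if there is a permutation `π` of the nodes with
`g'{i,j} = g{π i, π j}` for all `i, j`. -/
def GraphIso {n : ℕ} {X : Type*} (g g' : Sym2 (Fin n) → X) : Prop :=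
  ∃ π : Equiv.Perm (Fin n), ∀ i j : Fin n, g' s(i, j) = g s(π i, π j)

open Finset in
/-- A function symmetric in its first two arguments, summed over ordered triples of distinct
indices, in terms of its sum over increasing triples. -/
theorem sum_distinct_eq_two_mul_sum_lt {n : ℕ} (H : Fin n → Fin n → Fin n → ℕ)
    (hH : ∀ i j k, H i j k = H j i k) :
    ∑ i, ∑ j, ∑ k, (if i ≠ j ∧ k ≠ i ∧ k ≠ j then H i j k else 0) =
      2 * ∑ i, ∑ j, ∑ k, (if i < j ∧ j < k then H i j k + H i k j + H j k i else 0) := by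
  have swap₁₂ : ∀ P : Fin n → Fin n → Fin n → ℕ,
      ∑ i, ∑ j, ∑ k, P i j k = ∑ i, ∑ j, ∑ k, P j i k := fun P => sum_comm
  have swap₂₃ : ∀ P : Fin n → Fin n → Fin n → ℕ,
      ∑ i, ∑ j, ∑ k, P i j k = ∑ i, ∑ j, ∑ k, P i k j :=
    fun P => sum_congr rfl fun i _ => sum_comm
  have split : ∀ i j k : Fin n, (if i ≠ j ∧ k ≠ i ∧ k ≠ j then H i j k else 0) =
      (if i < j ∧ j < k then H i j k else 0) + (if j < i ∧ i < k then H i j k else 0) +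
      (if i < k ∧ k < j then H i j k else 0) + (if j < k ∧ k < i then H i j k else 0) +
      (if k < i ∧ i < j then H i j k else 0) + (if k < j ∧ j < i then H i j k else 0) := by
    intro i j k
    grind
  have split' : ∀ i j k : Fin n,
      (if i < j ∧ j < k then H i j k + H i k j + H j k i else 0) =
      (if i < j ∧ j < k then H i j k else 0) + (if i < j ∧ j < k then H i k j else 0) +
      (if i < j ∧ j < k then H j k i else 0) := by
    intro i j k
    split_ifs <;> rfl
  simp only [split, split', sum_add_distrib]
  have h2 : ∑ i, ∑ j, ∑ k, (if j < i ∧ i < k then H i j k else 0) =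
      ∑ i, ∑ j, ∑ k, (if i < j ∧ j < k then H i j k else 0) := by
    rw [swap₁₂]; simp only [hH]
  have h3 : ∑ i, ∑ j, ∑ k, (if i < k ∧ k < j then H i j k else 0) =
      ∑ i, ∑ j, ∑ k, (if i < j ∧ j < k then H i k j else 0) := swap₂₃ _
  have h4 : ∑ i, ∑ j, ∑ k, (if j < k ∧ k < i then H i j k else 0) =
      ∑ i, ∑ j, ∑ k, (if i < j ∧ j < k then H i k j else 0) := by
    rw [swap₁₂, swap₂₃]; simp only [hH]
  have h5 : ∑ i, ∑ j, ∑ k, (if k < i ∧ i < j then H i j k else 0) =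
      ∑ i, ∑ j, ∑ k, (if i < j ∧ j < k then H j k i else 0) := by
    rw [swap₂₃, swap₁₂]
  have h6 : ∑ i, ∑ j, ∑ k, (if k < j ∧ j < i then H i j k else 0) =
      ∑ i, ∑ j, ∑ k, (if i < j ∧ j < k then H j k i else 0) := by
    rw [swap₁₂, swap₂₃, swap₁₂]; simp only [hH]
  omega

/-- Finite families of finite sets with the same number of supersets of every set contain every
set equally often. -/
theorem card_filter_eq_of_card_filter_subset {V X : Type*} [DecidableEq X]
    (s s' : Finset V) (f f' : V → Finset X)
    (h : ∀ A, (s.filter fun v => A ⊆ f v).card = (s'.filter fun v => A ⊆ f' v).card)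
    (A : Finset X) :
    (s.filter fun v => f v = A).card = (s'.filter fun v => f' v = A).card := by
  classical
  set U : Finset X := s.biUnion f ∪ s'.biUnion f' with hU
  have key : ∀ (t : Finset V) (p : V → Finset X) (A : Finset X), (∀ v ∈ t, p v ⊆ U) →
      (t.filter fun v => A ⊆ p v).card = (t.filter fun v => p v = A).card +
        ∑ B ∈ U.powerset.filter (A ⊂ ·), (t.filter fun v => p v = B).card := by
    intro t p A hp
    have h1 : (t.filter fun v => A ⊆ p v) =
        (t.filter fun v => p v = A) ∪ (t.filter fun v => A ⊂ p v) := by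
      ext v
      simp only [Finset.mem_filter, Finset.mem_union, ssubset_iff_subset_ne]
      grind
    rw [h1, Finset.card_union_of_disjoint]
    · congr 1
      rw [Finset.card_eq_sum_card_fiberwise (f := p) (t := U.powerset.filter (A ⊂ ·))]
      · refine Finset.sum_congr rfl fun B hB => ?_
        rw [Finset.filter_filter]
        congr 1
        refine Finset.filter_congr fun v _ => ?_
        simp only [Finset.mem_filter] at hB
        constructor
        · exact fun h => h.2
        · rintro rfl
          exact ⟨hB.2, rfl⟩
      · intro v hv
        simp only [Finset.coe_filter, Set.mem_ofPred_eq, Finset.mem_powerset] at hv ⊢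
        exact ⟨hp v hv.1, hv.2⟩
    · rw [Finset.disjoint_filter]
      rintro v _ rfl
      exact fun h => h.ne rfl
  induction hm : U.card - A.card using Nat.strong_induction_on generalizing A with
  | _ m ih =>
    have e := h A
    rw [key s f A fun v hv => (Finset.subset_biUnion_of_mem f hv).trans Finset.subset_union_left,
      key s' f' A fun v hv => (Finset.subset_biUnion_of_mem f' hv).trans Finset.subset_union_right,
      Finset.sum_congr rfl fun B hB => ?_] at e
    · exact Nat.add_right_cancel e
    · simp only [Finset.mem_filter, Finset.mem_powerset] at hB
      have h1 := Finset.card_lt_card hB.2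
      have h2 := Finset.card_le_card hB.1
      exact ih _ (by omega) B rfl

/-- Functions on a finite type with equal fibre cardinalities differ by a permutation. -/
theorem exists_perm_of_card_fiber_eq {V Y : Type*} [Fintype V] [DecidableEq Y] (f f' : V → Y)
    (h : ∀ y, (Finset.univ.filter fun v => f v = y).card =
      (Finset.univ.filter fun v => f' v = y).card) :
    ∃ π : Equiv.Perm V, ∀ v, f' (π v) = f v := by
  have e : ∀ y, Nonempty ({v // f v = y} ≃ {v // f' v = y}) := fun y =>
    Fintype.card_eq.mp (by simpa only [Fintype.card_subtype] using h y)
  exact ⟨Equiv.ofFiberEquiv fun y => (e y).some, fun v => Equiv.ofFiberEquiv_map _ v⟩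

theorem Multiset.pair_eq_pair {α : Type*} {a b c d : α} (h : ({a, b} : Multiset α) = {c, d}) :
    (a = c ∧ b = d) ∨ (a = d ∧ b = c) := by
  rw [Multiset.insert_eq_cons, Multiset.insert_eq_cons, Multiset.cons_eq_cons] at h
  simp only [Multiset.singleton_eq_cons_iff, Multiset.singleton_inj] at h
  grind

theorem Multiset.triple_eq_triple {α : Type*} {p q r p' q' r' : α}
    (e : ({p, q, r} : Multiset α) = {p', q', r'}) :
    (p = p' ∧ q = q' ∧ r = r') ∨ (p = p' ∧ q = r' ∧ r = q') ∨
      (p = q' ∧ q = p' ∧ r = r') ∨ (p = q' ∧ q = r' ∧ r = p') ∨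
      (p = r' ∧ q = p' ∧ r = q') ∨ (p = r' ∧ q = q' ∧ r = p') := by
  have hp : p ∈ ({p', q', r'} : Multiset α) := e ▸ Multiset.mem_cons_self _ _
  simp only [Multiset.insert_eq_cons, Multiset.mem_cons, Multiset.mem_singleton] at hp e
  rcases hp with rfl | rfl | rfl
  · rcases Multiset.pair_eq_pair ((Multiset.cons_inj_right _).mp e) with
      ⟨rfl, rfl⟩ | ⟨rfl, rfl⟩ <;> simp
  · rw [Multiset.cons_swap p' p] at e
    rcases Multiset.pair_eq_pair ((Multiset.cons_inj_right _).mp e) with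
      ⟨rfl, rfl⟩ | ⟨rfl, rfl⟩ <;> simp
  · rw [← Multiset.insert_eq_cons q', Multiset.pair_comm, Multiset.insert_eq_cons,
      Multiset.cons_swap p' p] at e
    rcases Multiset.pair_eq_pair ((Multiset.cons_inj_right _).mp e) with
      ⟨rfl, rfl⟩ | ⟨rfl, rfl⟩ <;> simp

section Graph

variable {n : ℕ} {X : Type*} {g g' : Sym2 (Fin n) → X}

theorem sum_map_triangleDist (g : Sym2 (Fin n) → X) (F : X × X → ℕ) :
    2 * ((triangleDist g).map fun t => (t.map F).sum).sum =
      ∑ i, ∑ j, ∑ k, (if i ≠ j ∧ k ≠ i ∧ k ≠ j then F (g s(i, j), g s(k, k)) else 0) := by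
  rw [sum_distinct_eq_two_mul_sum_lt (fun i j k => F (g s(i, j), g s(k, k)))
    fun i j k => by rw [Sym2.eq_swap]]
  congr 1
  have h : ((triangleDist g).map fun t => (t.map F).sum).sum =
      ∑ p ∈ (Finset.univ : Finset (Fin n × Fin n × Fin n)).filter
        (fun p => p.1 < p.2.1 ∧ p.2.1 < p.2.2),
        ((subtriangle g p.1 p.2.1 p.2.2).map F).sum := by
    rw [triangleDist, Multiset.map_map]
    rfl
  rw [h, Finset.sum_filter, Fintype.sum_prod_type]
  refine Finset.sum_congr rfl fun i _ => ?_
  rw [Fintype.sum_prod_type]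
  refine Finset.sum_congr rfl fun j _ => Finset.sum_congr rfl fun k _ => ?_
  simp [subtriangle, add_assoc]

theorem sum_distinct_eq_of_triangleDist_eq (h : triangleDist g' = triangleDist g)
    (F : X × X → ℕ) :
    ∑ i, ∑ j, ∑ k, (if i ≠ j ∧ k ≠ i ∧ k ≠ j then F (g' s(i, j), g' s(k, k)) else 0) =
      ∑ i, ∑ j, ∑ k, (if i ≠ j ∧ k ≠ i ∧ k ≠ j then F (g s(i, j), g s(k, k)) else 0) := by
  rw [← sum_map_triangleDist, h, sum_map_triangleDist]

theorem subtriangle_comm_left (g : Sym2 (Fin n) → X) (i j k : Fin n) :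
    subtriangle g i j k = subtriangle g j i k := by
  unfold subtriangle
  rw [Sym2.eq_swap (a := i) (b := j)]
  exact congrArg _ (Multiset.pair_comm _ _)

theorem subtriangle_comm_right (g : Sym2 (Fin n) → X) (i j k : Fin n) :
    subtriangle g i j k = subtriangle g i k j := by
  unfold subtriangle
  rw [Sym2.eq_swap (a := j) (b := k)]
  exact Multiset.cons_swap _ _ _

theorem mem_triangleDist {t : Multiset (X × X)} :
    t ∈ triangleDist g ↔ ∃ i j k, i ≠ j ∧ i ≠ k ∧ j ≠ k ∧ subtriangle g i j k = t := by
  simp only [triangleDist, Multiset.mem_map, Finset.mem_val, Finset.mem_filter,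
    Finset.mem_univ, true_and, Prod.exists]
  constructor
  · rintro ⟨i, j, k, ⟨h1, h2⟩, rfl⟩
    exact ⟨i, j, k, h1.ne, (h1.trans h2).ne, h2.ne, rfl⟩
  · rintro ⟨i, j, k, hij, hik, hjk, rfl⟩
    have hl := subtriangle_comm_left g
    have hr := subtriangle_comm_right g
    rcases lt_or_gt_of_ne hij with h1 | h1 <;> rcases lt_or_gt_of_ne hik with h2 | h2 <;>
      rcases lt_or_gt_of_ne hjk with h3 | h3
    · exact ⟨i, j, k, ⟨h1, h3⟩, rfl⟩
    · exact ⟨i, k, j, ⟨h2, h3⟩, hr ..⟩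
    · omega
    · exact ⟨k, i, j, ⟨h2, h1⟩, by rw [hl, hr]⟩
    · exact ⟨j, i, k, ⟨h1, h2⟩, hl ..⟩
    · omega
    · exact ⟨j, k, i, ⟨h3, h2⟩, by rw [hr, hl]⟩
    · exact ⟨k, j, i, ⟨h3, h1⟩, by rw [hl, hr, hl]⟩

theorem exists_matching_triangle (h : triangleDist g' = triangleDist g) {i j k : Fin n}
    (hij : i ≠ j) (hik : i ≠ k) (hjk : j ≠ k) :
    ∃ i' j' k', i' ≠ j' ∧ i' ≠ k' ∧ j' ≠ k' ∧ g' s(i', j') = g s(i, j) ∧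
      g' s(i', k') = g s(i, k) ∧ g' s(j', k') = g s(j, k) ∧ g' s(k', k') = g s(k, k) := by
  obtain ⟨a, b, c, hab, hac, hbc, e⟩ := mem_triangleDist.mp
    (h ▸ mem_triangleDist.mpr ⟨i, j, k, hij, hik, hjk, rfl⟩ :
      subtriangle g i j k ∈ triangleDist g')
  have swap : ∀ u v : Fin n, g' s(u, v) = g' s(v, u) := fun u v => by rw [Sym2.eq_swap]
  simp only [subtriangle] at e
  rcases Multiset.triple_eq_triple e with e | e | e | e | e | e <;> simp only [Prod.mk.injEq] at e
  · exact ⟨a, b, c, by grind⟩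
  · exact ⟨b, a, c, by grind⟩
  · exact ⟨a, c, b, by grind⟩
  · exact ⟨b, c, a, by grind⟩
  · exact ⟨c, a, b, by grind⟩
  · exact ⟨c, b, a, by grind⟩

/-- Exactly one edge has weight `c`. -/
def IsUniqueWeight (g : Sym2 (Fin n) → X) (c : X) : Prop :=
  (∃ i j, i ≠ j ∧ g s(i, j) = c) ∧
    ∀ i j k l, i ≠ j → k ≠ l → g s(i, j) = c → g s(k, l) = c → s(i, j) = s(k, l)

theorem isUniqueWeight_of_mem_uniqueEdges {i j : Fin n} (h : s(i, j) ∈ uniqueEdges g) :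
    IsUniqueWeight g (g s(i, j)) := by
  obtain ⟨hd, hu⟩ := h
  have key : ∀ a b, a ≠ b → g s(a, b) = g s(i, j) → s(a, b) = s(i, j) := fun a b hab e => by
    by_contra hne
    exact hu _ (by simpa using hab) hne e
  exact ⟨⟨i, j, by simpa using hd, rfl⟩, fun a b c d hab hcd h1 h2 =>
    (key a b hab h1).trans (key c d hcd h2).symm⟩

open Classical in
theorem isUniqueWeight_iff (c : X) : IsUniqueWeight g c ↔
    (Finset.univ.filter fun p : Fin n × Fin n => p.1 ≠ p.2 ∧ g s(p.1, p.2) = c).card = 2 := by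
  constructor
  · rintro ⟨⟨i, j, hij, hc⟩, hu⟩
    rw [Finset.card_eq_two]
    refine ⟨(i, j), (j, i), by simp [hij], ?_⟩
    ext ⟨a, b⟩
    simp only [Finset.mem_filter, Finset.mem_univ, true_and, Finset.mem_insert,
      Finset.mem_singleton, Prod.mk.injEq, ← Sym2.eq_iff]
    constructor
    · exact fun h => hu _ _ _ _ h.1 hij h.2 hc
    · intro h
      refine ⟨?_, h ▸ hc⟩
      rcases Sym2.eq_iff.mp h with ⟨rfl, rfl⟩ | ⟨rfl, rfl⟩
      exacts [hij, hij.symm]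
  · intro h2
    have key : ∀ i j k l, i ≠ j → k ≠ l → g s(i, j) = c → g s(k, l) = c →
        s(i, j) = s(k, l) := by
      intro i j k l hij hkl h1 h3
      have hs : ({(k, l), (l, k)} : Finset (Fin n × Fin n)) ⊆
          Finset.univ.filter fun p : Fin n × Fin n => p.1 ≠ p.2 ∧ g s(p.1, p.2) = c := by
        intro p hp
        simp only [Finset.mem_insert, Finset.mem_singleton] at hp
        rcases hp with rfl | rfl
        · simp [hkl, h3]
        · simp [hkl.symm, Sym2.eq_swap (a := l), h3]
      have heq := Finset.eq_of_subset_of_card_le hs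
        (by rw [h2, Finset.card_pair (by simp [hkl])])
      have hm : (i, j) ∈ ({(k, l), (l, k)} : Finset (Fin n × Fin n)) := by
        rw [heq]; simp [hij, h1]
      simpa using hm
    obtain ⟨p, hp⟩ := Finset.card_pos.mp (h2 ▸ Nat.two_pos)
    simp only [Finset.mem_filter, Finset.mem_univ, true_and] at hp
    exact ⟨⟨p.1, p.2, hp⟩, key⟩

theorem card_filter_ne_ne {i j : Fin n} (hij : i ≠ j) :
    (Finset.univ.filter fun k => k ≠ i ∧ k ≠ j).card = n - 2 := by
  have h : (Finset.univ.filter fun k => k ≠ i ∧ k ≠ j) = ({i, j} : Finset (Fin n))ᶜ := by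
    ext k; simp
  rw [h, Finset.card_compl, Finset.card_pair hij, Fintype.card_fin]

open Classical in
theorem sum_distinct_edge (g : Sym2 (Fin n) → X) (c : X) :
    ∑ i, ∑ j, ∑ k, (if i ≠ j ∧ k ≠ i ∧ k ≠ j then (if g s(i, j) = c then 1 else 0) else 0) =
      (n - 2) *
        (Finset.univ.filter fun p : Fin n × Fin n => p.1 ≠ p.2 ∧ g s(p.1, p.2) = c).card := by
  rw [Finset.card_filter, Fintype.sum_prod_type, Finset.mul_sum]
  refine Finset.sum_congr rfl fun i _ => ?_
  rw [Finset.mul_sum]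
  refine Finset.sum_congr rfl fun j _ => ?_
  by_cases hij : i = j
  · simp [hij]
  · by_cases hc : g s(i, j) = c
    · simp [hij, hc, ← card_filter_ne_ne hij]
    · simp [hc]

open Classical in
theorem sum_distinct_node (g : Sym2 (Fin n) → X) (x : X) :
    ∑ i, ∑ j, ∑ k, (if i ≠ j ∧ k ≠ i ∧ k ≠ j then (if g s(k, k) = x then 1 else 0) else 0) =
      (n - 2) * ((n - 1) * (Finset.univ.filter fun k => g s(k, k) = x).card) := by
  rw [Finset.sum_comm, Finset.sum_congr rfl fun j _ => Finset.sum_comm, Finset.sum_comm,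
    Finset.card_filter, Finset.mul_sum, Finset.mul_sum]
  refine Finset.sum_congr rfl fun k _ => ?_
  by_cases hk : g s(k, k) = x
  · have h : ∀ j, ∑ i, (if i ≠ j ∧ k ≠ i ∧ k ≠ j then (1 : ℕ) else 0) =
        if j ≠ k then n - 2 else 0 := by
      intro j
      by_cases hj : j = k
      · simp [hj]
      · rw [if_pos hj, ← card_filter_ne_ne hj, Finset.card_filter]
        refine Finset.sum_congr rfl fun i _ => ?_
        have : (i ≠ j ∧ k ≠ i ∧ k ≠ j) ↔ (i ≠ j ∧ i ≠ k) := by grind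
        simp only [this]
    simp only [hk, if_true, h, mul_one]
    rw [← Finset.sum_filter, Finset.sum_const, Finset.filter_ne', Finset.card_erase_of_mem
      (Finset.mem_univ _), Finset.card_univ, Fintype.card_fin, smul_eq_mul, mul_comm]
  · simp [hk]

open Classical in
theorem card_edge_eq (hn : 3 ≤ n) (h : triangleDist g' = triangleDist g) (c : X) :
    (Finset.univ.filter fun p : Fin n × Fin n => p.1 ≠ p.2 ∧ g' s(p.1, p.2) = c).card =
      (Finset.univ.filter fun p : Fin n × Fin n => p.1 ≠ p.2 ∧ g s(p.1, p.2) = c).card := by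
  have e := sum_distinct_eq_of_triangleDist_eq h fun p => if p.1 = c then 1 else 0
  rw [sum_distinct_edge, sum_distinct_edge] at e
  exact Nat.eq_of_mul_eq_mul_left (by omega) e

open Classical in
theorem card_node_eq (hn : 3 ≤ n) (h : triangleDist g' = triangleDist g) (x : X) :
    (Finset.univ.filter fun k => g' s(k, k) = x).card =
      (Finset.univ.filter fun k => g s(k, k) = x).card := by
  have e := sum_distinct_eq_of_triangleDist_eq h fun p => if p.2 = x then 1 else 0
  rw [sum_distinct_node, sum_distinct_node] at e
  exact Nat.eq_of_mul_eq_mul_left (by omega) (Nat.eq_of_mul_eq_mul_left (by omega) e)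

theorem isUniqueWeight_congr (hn : 3 ≤ n) (h : triangleDist g' = triangleDist g) (c : X) :
    IsUniqueWeight g' c ↔ IsUniqueWeight g c := by
  classical
  rw [isUniqueWeight_iff, isUniqueWeight_iff, card_edge_eq hn h]

open Classical in
/-- The unique weights among the edges at the node `v`. -/
noncomputable def nodeStar (g : Sym2 (Fin n) → X) (v : Fin n) : Finset X :=
  ((Finset.univ.erase v).image fun u => g s(u, v)).filter (IsUniqueWeight g)

theorem mem_star {v : Fin n} {c : X} :
    c ∈ nodeStar g v ↔ (∃ u, u ≠ v ∧ g s(u, v) = c) ∧ IsUniqueWeight g c := by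
  simp [nodeStar]

open Classical in
theorem sum_distinct_add_card_star {c : X} (hc : IsUniqueWeight g c) (x : X) :
    ∑ i, ∑ j, ∑ k, (if i ≠ j ∧ k ≠ i ∧ k ≠ j then
        (if (g s(i, j), g s(k, k)) = (c, x) then 1 else 0) else 0) +
      2 * (Finset.univ.filter fun k => c ∈ nodeStar g k ∧ g s(k, k) = x).card =
      2 * (Finset.univ.filter fun k => g s(k, k) = x).card := by
  obtain ⟨⟨a, b, hab, hc1⟩, hu⟩ := id hc
  have hstar : ∀ k, c ∈ nodeStar g k ↔ k = a ∨ k = b := by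
    intro k
    rw [mem_star, and_iff_left hc]
    constructor
    · rintro ⟨u, huk, e⟩
      have := hu u k a b huk hab e hc1
      rw [Sym2.eq_iff] at this
      tauto
    · rintro (rfl | rfl)
      · exact ⟨b, hab.symm, by rw [Sym2.eq_swap, hc1]⟩
      · exact ⟨a, hab, hc1⟩
  have hpair : ∀ i j k : Fin n, (if i ≠ j ∧ k ≠ i ∧ k ≠ j then
        (if (g s(i, j), g s(k, k)) = (c, x) then 1 else 0) else 0) =
      (if i = a then if j = b then if c ∉ nodeStar g k ∧ g s(k, k) = x then 1 else 0 else 0 else 0) +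
      (if i = b then if j = a then if c ∉ nodeStar g k ∧ g s(k, k) = x then 1 else 0 else 0 else 0)
      := by
    intro i j k
    have h1 : (i ≠ j ∧ g s(i, j) = c) ↔ (i = a ∧ j = b) ∨ (i = b ∧ j = a) := by
      constructor
      · exact fun h => Sym2.eq_iff.mp (hu _ _ _ _ h.1 hab h.2 hc1)
      · rintro (⟨rfl, rfl⟩ | ⟨rfl, rfl⟩)
        · exact ⟨hab, hc1⟩
        · exact ⟨hab.symm, by rw [Sym2.eq_swap, hc1]⟩
    simp only [Prod.mk.injEq, hstar]
    grind
  simp only [hpair, Finset.sum_add_distrib]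
  have hsum : ∀ p q : Fin n, ∑ i, ∑ j, ∑ k,
      (if i = p then if j = q then if c ∉ nodeStar g k ∧ g s(k, k) = x then 1 else 0 else 0 else 0) =
      (Finset.univ.filter fun k => c ∉ nodeStar g k ∧ g s(k, k) = x).card := by
    intro p q
    rw [Finset.card_filter, Finset.sum_eq_single p, Finset.sum_eq_single q]
    · simp
    · intro j _ hj; simp [hj]
    · simp
    · intro i _ hi; simp [hi]
    · simp
  rw [hsum, hsum]
  have hsplit := Finset.card_filter_add_card_filter_not
    (s := Finset.univ.filter fun k => g s(k, k) = x) (fun k => c ∈ nodeStar g k)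
  simp only [Finset.filter_filter, and_comm] at hsplit ⊢
  omega

theorem exists_star_subset (hn : 3 ≤ n) (h : triangleDist g' = triangleDist g) {v : Fin n}
    {a b : X} (ha : a ∈ nodeStar g v) (hb : b ∈ nodeStar g v) (hab : a ≠ b) :
    ∃ v', nodeStar g v ⊆ nodeStar g' v' ∧ g' s(v', v') = g s(v, v) := by
  have transfer := isUniqueWeight_congr hn h
  obtain ⟨⟨i, hi, rfl⟩, hua⟩ := mem_star.mp ha
  obtain ⟨⟨j, hj, rfl⟩, hub⟩ := mem_star.mp hb
  have hij : i ≠ j := by rintro rfl; exact hab rfl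
  obtain ⟨i', j', v', hij', hiv', hjv', e1, e2, e3, e4⟩ := exists_matching_triangle h hij hi hj
  refine ⟨v', fun c hc => ?_, e4⟩
  obtain ⟨⟨k, hk, rfl⟩, huc⟩ := mem_star.mp hc
  have huc' := (transfer _).mpr huc
  refine mem_star.mpr ⟨?_, huc'⟩
  by_cases hki : k = i
  · exact ⟨i', hiv', by rw [e2, hki]⟩
  by_cases hkj : k = j
  · exact ⟨j', hjv', by rw [e3, hkj]⟩
  obtain ⟨i₁, k₁, v₁, hik₁, hiv₁, hkv₁, -, f2, f3, -⟩ :=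
    exists_matching_triangle h (Ne.symm hki) hi hk
  obtain ⟨j₂, k₂, v₂, hjk₂, hjv₂, hkv₂, -, d2, d3, -⟩ :=
    exists_matching_triangle h (Ne.symm hkj) hj hk
  have s1 := ((transfer _).mpr hua).2 _ _ _ _ hiv₁ hiv' f2 e2
  have s2 := ((transfer _).mpr hub).2 _ _ _ _ hjv₂ hjv' d2 e3
  have s3 := huc'.2 _ _ _ _ hkv₁ hkv₂ f3 d3
  by_cases hv₁ : v₁ = v'
  · exact ⟨k₁, hv₁ ▸ hkv₁, hv₁ ▸ f3⟩
  by_cases hk₁ : k₁ = v'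
  · exact ⟨v₁, hv₁, by rw [← f3, hk₁, Sym2.eq_swap]⟩
  exfalso
  rw [Sym2.eq_iff] at s1 s2 s3
  have hkv : s(k₁, v₁) = s(i', j') := by
    rw [Sym2.eq_iff]
    grind
  rw [hkv, e1] at f3
  have := huc.2 _ _ _ _ hij hk f3 rfl
  rw [Sym2.eq_iff] at this
  grind

theorem eq_of_mem_star {v v' : Fin n} {a b : X} (ha : a ∈ nodeStar g v) (hb : b ∈ nodeStar g v)
    (ha' : a ∈ nodeStar g v') (hb' : b ∈ nodeStar g v') (hab : a ≠ b) : v = v' := by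
  obtain ⟨⟨i, hi, hia⟩, hua⟩ := mem_star.mp ha
  obtain ⟨⟨j, hj, hjb⟩, hub⟩ := mem_star.mp hb
  obtain ⟨⟨i', hi', hia'⟩, -⟩ := mem_star.mp ha'
  obtain ⟨⟨j', hj', hjb'⟩, -⟩ := mem_star.mp hb'
  have s1 := hua.2 _ _ _ _ hi hi' hia hia'
  have s2 := hub.2 _ _ _ _ hj hj' hjb hjb'
  rw [Sym2.eq_iff] at s1 s2
  by_contra hne
  have : i = j := by grind
  exact hab (by rw [← hia, ← hjb, this])

open Classical in
theorem card_star_superset_le (hn : 3 ≤ n) (h : triangleDist g' = triangleDist g)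
    {A : Finset X} (hA : 1 < A.card) (x : X) :
    ((Finset.univ.filter fun v => g s(v, v) = x).filter fun v => A ⊆ nodeStar g v).card ≤
      ((Finset.univ.filter fun v => g' s(v, v) = x).filter fun v => A ⊆ nodeStar g' v).card := by
  obtain ⟨a, ha, b, hb, hab⟩ := Finset.one_lt_card.mp hA
  rcases Finset.eq_empty_or_nonempty
    ((Finset.univ.filter fun v => g s(v, v) = x).filter fun v => A ⊆ nodeStar g v) with he | ⟨v, hv⟩
  · simp [he]
  · refine (Finset.card_le_one.mpr fun u hu u' hu' => ?_).trans (Finset.card_pos.mpr ?_)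
    · simp only [Finset.mem_filter, Finset.mem_univ, true_and] at hu hu'
      exact eq_of_mem_star (hu.2 ha) (hu.2 hb) (hu'.2 ha) (hu'.2 hb) hab
    · simp only [Finset.mem_filter, Finset.mem_univ, true_and] at hv
      obtain ⟨v', h1, h2⟩ := exists_star_subset hn h (hv.2 ha) (hv.2 hb) hab
      exact ⟨v', by simp [h2, hv.1, hv.2.trans h1]⟩

open Classical in
theorem card_star_superset_eq (hn : 3 ≤ n) (h : triangleDist g' = triangleDist g)
    (A : Finset X) (x : X) :
    ((Finset.univ.filter fun v => g s(v, v) = x).filter fun v => A ⊆ nodeStar g v).card =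
      ((Finset.univ.filter fun v => g' s(v, v) = x).filter fun v => A ⊆ nodeStar g' v).card := by
  rcases lt_trichotomy A.card 1 with hA | hA | hA
  · obtain rfl : A = ∅ := by simpa using hA
    simpa using (card_node_eq hn h x).symm
  · obtain ⟨c, rfl⟩ := Finset.card_eq_one.mp hA
    by_cases hc : IsUniqueWeight g c
    · have e := sum_distinct_eq_of_triangleDist_eq h fun p => if p = (c, x) then 1 else 0
      have e1 := sum_distinct_add_card_star hc x
      have e2 := sum_distinct_add_card_star ((isUniqueWeight_congr hn h c).mpr hc) x
      have e3 := card_node_eq hn h x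
      simp only [Finset.singleton_subset_iff, Finset.filter_filter]
      simp only [and_comm (b := g _ = x), and_comm (b := g' _ = x)] at e1 e2
      omega
    · have hc' := (isUniqueWeight_congr hn h c).not.mpr hc
      simp [mem_star, hc, hc']
  · exact le_antisymm (card_star_superset_le hn h hA x) (card_star_superset_le hn h.symm hA x)

theorem exists_perm_star_eq (hn : 3 ≤ n) (h : triangleDist g' = triangleDist g) :
    ∃ π : Equiv.Perm (Fin n), ∀ v, nodeStar g' (π v) = nodeStar g v ∧ g' s(π v, π v) = g s(v, v) := by
  classical
  obtain ⟨π, hπ⟩ := exists_perm_of_card_fiber_eq (fun v => (g s(v, v), nodeStar g v))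
    (fun v => (g' s(v, v), nodeStar g' v)) fun ⟨x, A⟩ => by
      have := card_filter_eq_of_card_filter_subset _ _ (nodeStar g) (nodeStar g')
        (fun A => card_star_superset_eq hn h A x) A
      simpa only [Finset.filter_filter, Prod.mk.injEq] using this
  exact ⟨π, fun v => ⟨congrArg Prod.snd (hπ v), congrArg Prod.fst (hπ v)⟩⟩

theorem apply_perm_of_isUniqueWeight {π : Equiv.Perm (Fin n)}
    (hπ : ∀ v, nodeStar g' (π v) = nodeStar g v) {i j : Fin n} (hij : i ≠ j)
    (hu : IsUniqueWeight g (g s(i, j))) : g' s(π i, π j) = g s(i, j) := by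
  have hi : g s(i, j) ∈ nodeStar g' (π i) :=
    hπ i ▸ mem_star.mpr ⟨⟨j, hij.symm, by rw [Sym2.eq_swap]⟩, hu⟩
  have hj : g s(i, j) ∈ nodeStar g' (π j) := hπ j ▸ mem_star.mpr ⟨⟨i, hij, rfl⟩, hu⟩
  obtain ⟨⟨k, hk, ek⟩, hu'⟩ := mem_star.mp hi
  obtain ⟨⟨l, hl, el⟩, -⟩ := mem_star.mp hj
  have hs := hu'.2 _ _ _ _ hk hl ek el
  have hne : π i ≠ π j := π.injective.ne hij
  have hkj : k = π j := by
    rw [Sym2.eq_iff] at hs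
    grind
  rw [← ek, hkj, Sym2.eq_swap]

theorem apply_perm_of_common_neighbor (hn : 3 ≤ n) (h : triangleDist g' = triangleDist g)
    {π : Equiv.Perm (Fin n)} (hπ : ∀ v, nodeStar g' (π v) = nodeStar g v) {i j k : Fin n}
    (hij : i ≠ j) (hik : i ≠ k) (hjk : j ≠ k) (hi : IsUniqueWeight g (g s(i, k)))
    (hj : IsUniqueWeight g (g s(j, k))) : g' s(π i, π j) = g s(i, j) := by
  have ei := apply_perm_of_isUniqueWeight hπ hik hi
  have ej := apply_perm_of_isUniqueWeight hπ hjk hj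
  obtain ⟨i', j', k', hij', hik', hjk', e1, e2, e3, -⟩ := exists_matching_triangle h hij hik hjk
  have transfer := isUniqueWeight_congr hn h
  have s1 := ((transfer _).mpr hi).2 _ _ _ _ hik' (π.injective.ne hik) e2 ei
  have s2 := ((transfer _).mpr hj).2 _ _ _ _ hjk' (π.injective.ne hjk) e3 ej
  have hij'' := π.injective.ne hij
  rw [Sym2.eq_iff] at s1 s2
  obtain ⟨rfl, rfl⟩ : i' = π i ∧ j' = π j := by grind
  exact e1

/-- A permutation of the nodes that preserves all edge weights other than `x₀` preserves all edge
weights, provided every weight occurs equally often in both graphs. -/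
theorem apply_perm_of_apply_perm_ne {x₀ : X} {π : Equiv.Perm (Fin n)}
    (hcard : ∀ c, Nat.card {p : Fin n × Fin n // p.1 ≠ p.2 ∧ g' s(p.1, p.2) = c} =
      Nat.card {p : Fin n × Fin n // p.1 ≠ p.2 ∧ g s(p.1, p.2) = c})
    (hπ : ∀ i j, i ≠ j → g s(i, j) ≠ x₀ → g' s(π i, π j) = g s(i, j))
    {i j : Fin n} (hij : i ≠ j) : g' s(π i, π j) = g s(i, j) := by
  by_cases h0 : g s(i, j) = x₀
  · by_contra hne
    have hc : g' s(π i, π j) ≠ x₀ := h0 ▸ hne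
    let φ : {p : Fin n × Fin n // p.1 ≠ p.2 ∧ g s(p.1, p.2) = g' s(π i, π j)} →
        {p : Fin n × Fin n // p.1 ≠ p.2 ∧ g' s(p.1, p.2) = g' s(π i, π j)} :=
      fun p => ⟨(π p.1.1, π p.1.2), π.injective.ne p.2.1,
        (hπ _ _ p.2.1 (p.2.2.trans_ne hc)).trans p.2.2⟩
    have hφ : Function.Injective φ := by
      rintro ⟨⟨a, b⟩, _⟩ ⟨⟨c, d⟩, _⟩ e
      simpa [φ] using e
    have hsurj := ((Nat.bijective_iff_injective_and_card φ).mpr ⟨hφ, (hcard _).symm⟩).2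
    obtain ⟨⟨⟨a, b⟩, hab, e⟩, he⟩ := hsurj ⟨(π i, π j), π.injective.ne hij, rfl⟩
    simp only [φ, Subtype.mk.injEq, Prod.mk.injEq, EmbeddingLike.apply_eq_iff_eq] at he
    obtain ⟨rfl, rfl⟩ := he
    exact hne e.symm
  · exact hπ i j hij h0

end Graph

/-- Theorem: if every unordered pair `{i,j}` of distinct nodes either lies in
`E`, or is connected via a common node `k` by two edges in `E`, or has weight
`0`, then `G` is reconstructible from its distribution of subtriangles. -/
theorem reconstructible_of_triangleDist {n : ℕ} {X : Type*} [Zero X]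
    (hn : 3 ≤ n) (g : Sym2 (Fin n) → X)
    (hyp : ∀ i j : Fin n, i ≠ j →
      s(i, j) ∈ uniqueEdges g ∨
      (∃ k : Fin n, k ≠ i ∧ k ≠ j ∧ s(i, k) ∈ uniqueEdges g ∧
        s(j, k) ∈ uniqueEdges g) ∨
      g s(i, j) = 0) :
    ∀ g' : Sym2 (Fin n) → X, triangleDist g' = triangleDist g →
      GraphIso g g' := by
  classical
  intro g' h
  obtain ⟨π, hπ⟩ := exists_perm_star_eq hn h
  have hstar := fun v => (hπ v).1
  have key : ∀ i j, g' s(π i, π j) = g s(i, j) := by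
    intro i j
    by_cases hij : i = j
    · exact hij ▸ (hπ i).2
    refine apply_perm_of_apply_perm_ne (x₀ := 0) (fun c => ?_) (fun i j hij h0 => ?_) hij
    · simpa only [Nat.card_eq_fintype_card, Fintype.card_subtype] using card_edge_eq hn h c
    · rcases hyp i j hij with hu | ⟨k, hki, hkj, hi, hj⟩ | h0'
      · exact apply_perm_of_isUniqueWeight hstar hij (isUniqueWeight_of_mem_uniqueEdges hu)
      · exact apply_perm_of_common_neighbor hn h hstar hij hki.symm hkj.symm
          (isUniqueWeight_of_mem_uniqueEdges hi) (isUniqueWeight_of_mem_uniqueEdges hj)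
      · exact absurd h0' h0
  refine ⟨π.symm, fun i j => ?_⟩
  rw [← key, π.apply_symm_apply, π.apply_symm_apply]
end

section
/- Let G be a graph with n ≥ 3 nodes, with edge weights g_{i,j} and node weights w_i = g_{i,i}, taking values in a set X containing a distinguished element 0. Assume that for all i, j, k, l ∈ {1,…,n} with i ≠ j and k ≠ l, the equality g_{i,j} = g_{k,l} ≠ 0 implies {i,j} = {k,l} (i.e., 0 is the only edge weight between distinct nodes that may occur repeatedly). Then G is reconstructible from the distribution of subtriangles: every graph G' with n nodes and weights in X satisfying T_{G'} = T_G is isomorphic to G. -/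
section OrderedTriples

variable {n : ℕ}

theorem sum_distinct_eq_six_mul (F : Fin n → Fin n → Fin n → ℕ)
    (h₁ : ∀ i j k, F i j k = F j i k) (h₂ : ∀ i j k, F i j k = F i k j) :
    (∑ i, ∑ j, ∑ k, if i ≠ j ∧ i ≠ k ∧ j ≠ k then F i j k else 0) =
      6 * ∑ i, ∑ j, ∑ k, if i < j ∧ j < k then F i j k else 0 := by
  set O : Fin n → Fin n → Fin n → ℕ := fun i j k => if i < j ∧ j < k then F i j k else 0 with hO
  have key : ∀ i j k, (if i ≠ j ∧ i ≠ k ∧ j ≠ k then F i j k else 0) =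
      O i j k + O i k j + O j i k + O j k i + O k i j + O k j i := by
    intro i j k
    have e₁ : F i k j = F i j k := (h₂ _ _ _).symm
    have e₂ : F j i k = F i j k := (h₁ _ _ _).symm
    have e₃ : F j k i = F i j k := by rw [h₂, e₂]
    have e₄ : F k i j = F i j k := by rw [h₁, e₁]
    have e₅ : F k j i = F i j k := by rw [h₂, e₄]
    simp only [hO, e₁, e₂, e₃, e₄, e₅]
    split_ifs <;> omega
  simp only [key, Finset.sum_add_distrib]
  have s₁ : ∑ i, ∑ j, ∑ k, O i k j = ∑ i, ∑ j, ∑ k, O i j k :=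
    Finset.sum_congr rfl fun i _ => Finset.sum_comm
  have s₂ : ∑ i, ∑ j, ∑ k, O j i k = ∑ i, ∑ j, ∑ k, O i j k := Finset.sum_comm
  have s₃ : ∑ i, ∑ j, ∑ k, O j k i = ∑ i, ∑ j, ∑ k, O i j k := by
    rw [Finset.sum_comm]
    exact Finset.sum_congr rfl fun i _ => Finset.sum_comm
  have s₄ : ∑ i, ∑ j, ∑ k, O k i j = ∑ i, ∑ j, ∑ k, O i j k := by
    rw [← s₂]
    exact Finset.sum_congr rfl fun i _ => Finset.sum_comm
  have s₅ : ∑ i, ∑ j, ∑ k, O k j i = ∑ i, ∑ j, ∑ k, O i j k := by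
    rw [← s₄, Finset.sum_comm]
  rw [s₁, s₂, s₃, s₄, s₅]
  ring

theorem sum_distinct_const (i j : Fin n) (c : ℕ) :
    (∑ k, if i ≠ j ∧ i ≠ k ∧ j ≠ k then c else 0) = if i ≠ j then (n - 2) * c else 0 := by
  split_ifs with h
  · rw [← Finset.sum_filter, Finset.sum_const, smul_eq_mul]
    have : (Finset.univ.filter fun k => i ≠ j ∧ i ≠ k ∧ j ≠ k) = ({i, j} : Finset (Fin n))ᶜ := by
      ext k
      simp [h, eq_comm]
    rw [this, Finset.card_compl, Finset.card_pair h, Fintype.card_fin]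
  · simp [h]

end OrderedTriples

section Reconstruction

variable {n : ℕ} {X : Type*}

theorem subtriangle_swap_left (g : Sym2 (Fin n) → X) (i j k : Fin n) :
    subtriangle g j i k = subtriangle g i j k := by
  simp only [subtriangle, Multiset.insert_eq_cons, Sym2.eq_swap (a := j) (b := i)]
  exact congrArg _ (Multiset.cons_swap _ _ _)

theorem subtriangle_swap_right (g : Sym2 (Fin n) → X) (i j k : Fin n) :
    subtriangle g i k j = subtriangle g i j k := by
  simp only [subtriangle, Multiset.insert_eq_cons, Sym2.eq_swap (a := k) (b := j)]
  exact Multiset.cons_swap _ _ _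

theorem subtriangle_mem_triangleDist (g : Sym2 (Fin n) → X) {i j k : Fin n}
    (hij : i ≠ j) (hik : i ≠ k) (hjk : j ≠ k) : subtriangle g i j k ∈ triangleDist g := by
  have mem : ∀ a b c : Fin n, a < b → b < c → subtriangle g a b c ∈ triangleDist g :=
    fun a b c hab hbc => Multiset.mem_map.2 ⟨(a, b, c), by simp [hab, hbc], rfl⟩
  rcases lt_or_gt_of_ne hij with h₁ | h₁ <;> rcases lt_or_gt_of_ne hik with h₂ | h₂ <;>
    rcases lt_or_gt_of_ne hjk with h₃ | h₃
  · exact mem _ _ _ h₁ h₃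
  · rw [← subtriangle_swap_right]; exact mem _ _ _ h₂ h₃
  · omega
  · rw [← subtriangle_swap_right, ← subtriangle_swap_left]; exact mem _ _ _ h₂ h₁
  · rw [← subtriangle_swap_left]; exact mem _ _ _ h₁ h₂
  · omega
  · rw [← subtriangle_swap_left, ← subtriangle_swap_right]; exact mem _ _ _ h₃ h₂
  · rw [← subtriangle_swap_left, ← subtriangle_swap_right, ← subtriangle_swap_left]
    exact mem _ _ _ h₃ h₁

theorem exists_of_mem_triangleDist {g : Sym2 (Fin n) → X} {t : Multiset (X × X)}
    (h : t ∈ triangleDist g) :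
    ∃ i j k : Fin n, i ≠ j ∧ i ≠ k ∧ j ≠ k ∧ subtriangle g i j k = t := by
  obtain ⟨⟨i, j, k⟩, hp, rfl⟩ := Multiset.mem_map.1 h
  simp only [Finset.mem_val, Finset.mem_filter, Finset.mem_univ, true_and] at hp
  exact ⟨i, j, k, hp.1.ne, (hp.1.trans hp.2).ne, hp.2.ne, rfl⟩

/-- Equality of triangle distributions transports each triangle, with all its edge and node
weights, from one graph to the other. -/
theorem exists_matching_triangle_s4 {g g' : Sym2 (Fin n) → X} (hT : triangleDist g' = triangleDist g)
    {u v w : Fin n} (huv : u ≠ v) (huw : u ≠ w) (hvw : v ≠ w) :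
    ∃ i j k : Fin n, i ≠ j ∧ i ≠ k ∧ j ≠ k ∧
      g' s(i, j) = g s(u, v) ∧ g' s(i, k) = g s(u, w) ∧ g' s(j, k) = g s(v, w) ∧
      g' s(i, i) = g s(u, u) ∧ g' s(j, j) = g s(v, v) ∧ g' s(k, k) = g s(w, w) := by
  classical
  obtain ⟨i, j, k, hij, hik, hjk, h⟩ := exists_of_mem_triangleDist
    (hT ▸ subtriangle_mem_triangleDist g huv huw hvw)
  have hji := hij.symm
  have hki := hik.symm
  have hkj := hjk.symm
  have e₁ : g' s(j, i) = g' s(i, j) := congrArg g' Sym2.eq_swap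
  have e₂ : g' s(k, i) = g' s(i, k) := congrArg g' Sym2.eq_swap
  have e₃ : g' s(k, j) = g' s(j, k) := congrArg g' Sym2.eq_swap
  have pair : ∀ p q r s : X × X, p ::ₘ {q} = r ::ₘ ({s} : Multiset (X × X)) →
      p = r ∧ q = s ∨ p = s ∧ q = r := by
    intro p q r s h
    rw [Multiset.cons_eq_cons] at h
    rcases h with h | ⟨-, cs, h₁, h₂⟩
    · simpa using Or.inl h
    · exact Or.inr ⟨((Multiset.singleton_eq_cons_iff _).1 h₂).1.symm,
        ((Multiset.singleton_eq_cons_iff _).1 h₁).1⟩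
  have rotate : ∀ p q r : X × X, p ::ₘ q ::ₘ ({r} : Multiset (X × X)) = r ::ₘ p ::ₘ {q} := by
    intro p q r
    rw [Multiset.cons_swap r p, ← Multiset.insert_eq_cons q, Multiset.pair_comm,
      Multiset.insert_eq_cons]
  simp only [subtriangle, Multiset.insert_eq_cons] at h
  have hmem : (g' s(i, j), g' s(k, k)) ∈ (g s(u, v), g s(w, w)) ::ₘ (g s(u, w), g s(v, v)) ::ₘ
      ({(g s(v, w), g s(u, u))} : Multiset (X × X)) := h ▸ Multiset.mem_cons_self _ _
  simp only [Multiset.mem_cons, Multiset.mem_singleton] at hmem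
  rcases hmem with hm | hm | hm
  · rw [hm, Multiset.cons_inj_right] at h
    simp only [Prod.mk.injEq] at hm
    rcases pair _ _ _ _ h with ⟨ha, hb⟩ | ⟨ha, hb⟩ <;> simp only [Prod.mk.injEq] at ha hb
    · exact ⟨i, j, k, by grind⟩
    · exact ⟨j, i, k, by grind⟩
  · rw [hm, Multiset.cons_swap (g s(u, v), _), Multiset.cons_inj_right] at h
    simp only [Prod.mk.injEq] at hm
    rcases pair _ _ _ _ h with ⟨ha, hb⟩ | ⟨ha, hb⟩ <;> simp only [Prod.mk.injEq] at ha hb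
    · exact ⟨i, k, j, by grind⟩
    · exact ⟨j, k, i, by grind⟩
  · rw [hm, rotate (g s(u, v), _), Multiset.cons_inj_right] at h
    simp only [Prod.mk.injEq] at hm
    rcases pair _ _ _ _ h with ⟨ha, hb⟩ | ⟨ha, hb⟩ <;> simp only [Prod.mk.injEq] at ha hb
    · exact ⟨k, i, j, by grind⟩
    · exact ⟨k, j, i, by grind⟩

theorem sum_triangleDist (g : Sym2 (Fin n) → X) (φ : X × X → ℕ) :
    2 * ((triangleDist g).map fun t => (t.map φ).sum).sum =
      ∑ i, ∑ j, ∑ k, if i ≠ j ∧ i ≠ k ∧ j ≠ k then φ (g s(i, j), g s(k, k)) else 0 := by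
  set F : Fin n → Fin n → Fin n → ℕ := fun i j k => ((subtriangle g i j k).map φ).sum with hF
  have hsix := sum_distinct_eq_six_mul F
    (fun i j k => by simp only [hF, subtriangle_swap_left g i j k])
    (fun i j k => by simp only [hF, subtriangle_swap_right g i j k])
  have hdist : ((triangleDist g).map fun t => (t.map φ).sum).sum =
      ∑ i, ∑ j, ∑ k, if i < j ∧ j < k then F i j k else 0 := by
    rw [triangleDist, Multiset.map_map]
    change ∑ p ∈ Finset.univ.filter (fun p : Fin n × Fin n × Fin n => p.1 < p.2.1 ∧ p.2.1 < p.2.2),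
      F p.1 p.2.1 p.2.2 = _
    rw [Finset.sum_filter]
    simp only [Fintype.sum_prod_type]
  set f : Fin n → Fin n → Fin n → ℕ := fun i j k =>
    if i ≠ j ∧ i ≠ k ∧ j ≠ k then φ (g s(i, j), g s(k, k)) else 0 with hf
  have hsplit : (∑ i, ∑ j, ∑ k, if i ≠ j ∧ i ≠ k ∧ j ≠ k then F i j k else 0) =
      3 * ∑ i, ∑ j, ∑ k, f i j k := by
    have key : ∀ i j k, (if i ≠ j ∧ i ≠ k ∧ j ≠ k then F i j k else 0) =
        f i j k + f i k j + f j k i := by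
      intro i j k
      simp only [hF, hf, subtriangle, Multiset.insert_eq_cons, Multiset.map_cons,
        Multiset.map_singleton, Multiset.sum_cons, Multiset.sum_singleton]
      split_ifs <;> omega
    simp only [key, Finset.sum_add_distrib]
    have s₁ : ∑ i, ∑ j, ∑ k, f i k j = ∑ i, ∑ j, ∑ k, f i j k :=
      Finset.sum_congr rfl fun i _ => Finset.sum_comm
    have s₂ : ∑ i, ∑ j, ∑ k, f j k i = ∑ i, ∑ j, ∑ k, f i j k := by
      rw [Finset.sum_comm]
      exact Finset.sum_congr rfl fun i _ => Finset.sum_comm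
    rw [s₁, s₂]
    ring
  have h := hsix.symm.trans hsplit
  change _ = ∑ i, ∑ j, ∑ k, f i j k
  omega

theorem card_edges_eq_of_triangleDist_eq [DecidableEq X] (hn : 3 ≤ n) {g g' : Sym2 (Fin n) → X}
    (hT : triangleDist g' = triangleDist g) (a : X) :
    (Finset.univ.filter fun p : Fin n × Fin n => p.1 ≠ p.2 ∧ g' s(p.1, p.2) = a).card =
      (Finset.univ.filter fun p : Fin n × Fin n => p.1 ≠ p.2 ∧ g s(p.1, p.2) = a).card := by
  have count : ∀ h : Sym2 (Fin n) → X,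
      2 * ((triangleDist h).map fun t => (t.map fun p => if p.1 = a then 1 else 0).sum).sum =
        (n - 2) * (Finset.univ.filter
          fun p : Fin n × Fin n => p.1 ≠ p.2 ∧ h s(p.1, p.2) = a).card := by
    intro h
    rw [sum_triangleDist, Finset.card_filter, Finset.mul_sum, Fintype.sum_prod_type]
    refine Finset.sum_congr rfl fun i _ => Finset.sum_congr rfl fun j _ => ?_
    refine (sum_distinct_const i j (if h s(i, j) = a then 1 else 0)).trans ?_
    by_cases h₁ : i = j <;> by_cases h₂ : h s(i, j) = a <;> simp [h₁, h₂]
  have h := (count g').symm.trans (hT ▸ count g)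
  exact Nat.eq_of_mul_eq_mul_left (by omega) h

theorem card_nodes_eq_of_triangleDist_eq [DecidableEq X] (hn : 3 ≤ n) {g g' : Sym2 (Fin n) → X}
    (hT : triangleDist g' = triangleDist g) (x : X) :
    (Finset.univ.filter fun v : Fin n => g' s(v, v) = x).card =
      (Finset.univ.filter fun v : Fin n => g s(v, v) = x).card := by
  have count : ∀ h : Sym2 (Fin n) → X,
      2 * ((triangleDist h).map fun t => (t.map fun p => if p.2 = x then 1 else 0).sum).sum =
        ((n - 1) * (n - 2)) * (Finset.univ.filter fun v : Fin n => h s(v, v) = x).card := by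
    intro h
    rw [sum_triangleDist]
    have hcomm : ∀ f : Fin n → Fin n → Fin n → ℕ,
        ∑ i, ∑ j, ∑ k, f i j k = ∑ k, ∑ i, ∑ j, f i j k := by
      intro f
      rw [Finset.sum_comm (s := Finset.univ (α := Fin n)) (f := fun k i => ∑ j, f i j k)]
      exact Finset.sum_congr rfl fun i _ => Finset.sum_comm
    have hinner : ∀ i k : Fin n, (∑ j, if i ≠ j ∧ i ≠ k ∧ j ≠ k then
        (if h s(k, k) = x then 1 else 0) else 0) =
        if i ≠ k then (n - 2) * (if h s(k, k) = x then 1 else 0) else 0 := by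
      intro i k
      rw [← sum_distinct_const]
      exact Finset.sum_congr rfl fun j _ => if_congr (by grind) rfl rfl
    rw [hcomm, Finset.card_filter, Finset.mul_sum]
    refine Finset.sum_congr rfl fun k _ => ?_
    simp only [hinner]
    rw [← Finset.sum_filter, Finset.sum_const, smul_eq_mul, Finset.filter_ne',
      Finset.card_erase_of_mem (Finset.mem_univ _), Finset.card_univ, Fintype.card_fin, mul_assoc]
  have h := (count g').symm.trans (hT ▸ count g)
  exact Nat.eq_of_mul_eq_mul_left (Nat.mul_pos (by omega) (by omega)) h

variable [Zero X]

/-- Every nonzero edge weight occurs on only one edge. -/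
def DistinctEdgeWeights (g : Sym2 (Fin n) → X) : Prop :=
  ∀ i j k l : Fin n, i ≠ j → k ≠ l → g s(i, j) = g s(k, l) → g s(i, j) ≠ 0 → s(i, j) = s(k, l)

/-- The nonzero weights of the edges at a node. -/
def incidentWeights (g : Sym2 (Fin n) → X) (v : Fin n) : Set X :=
  {a | a ≠ 0 ∧ ∃ u, v ≠ u ∧ g s(v, u) = a}

theorem DistinctEdgeWeights.of_triangleDist_eq (hn : 3 ≤ n) {g g' : Sym2 (Fin n) → X}
    (hg : DistinctEdgeWeights g) (hT : triangleDist g' = triangleDist g) :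
    DistinctEdgeWeights g' := by
  classical
  intro i j k l hij hkl he hne
  by_contra hs
  have hcard := card_edges_eq_of_triangleDist_eq hn hT (g' s(i, j))
  have hle : (Finset.univ.filter fun p : Fin n × Fin n =>
      p.1 ≠ p.2 ∧ g s(p.1, p.2) = g' s(i, j)).card ≤ 2 := by
    rcases Finset.eq_empty_or_nonempty (Finset.univ.filter fun p : Fin n × Fin n =>
      p.1 ≠ p.2 ∧ g s(p.1, p.2) = g' s(i, j)) with h | ⟨⟨u, v⟩, h⟩
    · simp [h]
    · refine (Finset.card_le_card (t := {(u, v), (v, u)}) ?_).trans Finset.card_le_two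
      rintro ⟨p, q⟩ hpq
      simp only [Finset.mem_filter, Finset.mem_univ, true_and] at h hpq
      have := hg p q u v hpq.1 h.1 (hpq.2.trans h.2.symm) (hpq.2 ▸ hne)
      simpa [Sym2.eq_iff] using this
  have hge : 3 ≤ (Finset.univ.filter fun p : Fin n × Fin n =>
      p.1 ≠ p.2 ∧ g' s(p.1, p.2) = g' s(i, j)).card := by
    have hsub : ({(i, j), (j, i), (k, l)} : Finset (Fin n × Fin n)) ⊆
        Finset.univ.filter fun p => p.1 ≠ p.2 ∧ g' s(p.1, p.2) = g' s(i, j) := by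
      have : g' s(j, i) = g' s(i, j) := congrArg g' Sym2.eq_swap
      intro p hp
      simp only [Finset.mem_insert, Finset.mem_singleton] at hp
      rcases hp with rfl | rfl | rfl <;> simp [hij, hij.symm, hkl, he, this]
    refine le_trans (Finset.card_eq_three.2 ⟨_, _, _, ?_, ?_, ?_, rfl⟩).ge
      (Finset.card_le_card hsub) <;> simp only [Sym2.eq_iff] at hs <;> grind
  omega

theorem DistinctEdgeWeights.eq_of_mem_of_mem {g : Sym2 (Fin n) → X} (hg : DistinctEdgeWeights g)
    {a b : X} (hab : a ≠ b) {u v : Fin n} (hau : a ∈ incidentWeights g u)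
    (hbu : b ∈ incidentWeights g u) (hav : a ∈ incidentWeights g v)
    (hbv : b ∈ incidentWeights g v) : u = v := by
  obtain ⟨ha, y, hy, ey⟩ := hau
  obtain ⟨hb, z, hz, ez⟩ := hbu
  obtain ⟨-, y', hy', ey'⟩ := hav
  obtain ⟨-, z', hz', ez'⟩ := hbv
  have h₁ := hg u y v y' hy hy' (ey.trans ey'.symm) (ey ▸ ha)
  have h₂ := hg u z v z' hz hz' (ez.trans ez'.symm) (ez ▸ hb)
  simp only [Sym2.eq_iff] at h₁ h₂
  grind

theorem exists_matching_node {g g' : Sym2 (Fin n) → X} (hg : DistinctEdgeWeights g)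
    (hg' : DistinctEdgeWeights g') (hT : triangleDist g' = triangleDist g) {v : Fin n} {a b : X}
    (hab : a ≠ b) (hav : a ∈ incidentWeights g v) (hbv : b ∈ incidentWeights g v) :
    ∃ v', g' s(v', v') = g s(v, v) ∧ incidentWeights g v ⊆ incidentWeights g' v' := by
  obtain ⟨ha, y, hvy, ey⟩ := hav
  obtain ⟨hb, z, hvz, ez⟩ := hbv
  have hyz : y ≠ z := by rintro rfl; exact hab (ey.symm.trans ez)
  obtain ⟨v', y', z', hvy', hvz', hyz', ey', ez', -, ew, -, -⟩ :=
    exists_matching_triangle_s4 hT hvy hvz hyz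
  refine ⟨v', ew, ?_⟩
  rintro d ⟨hd, t, hvt, et⟩
  refine ⟨hd, ?_⟩
  by_cases hty : t = y
  · exact ⟨y', hvy', by rw [ey', ← hty, et]⟩
  by_cases htz : t = z
  · exact ⟨z', hvz', by rw [ez', ← htz, et]⟩
  obtain ⟨v₁, y₁, t₁, n₁, m₁, -, ey₁, et₁, -⟩ := exists_matching_triangle_s4 hT hvy hvt (Ne.symm hty)
  obtain ⟨v₂, z₂, t₂, n₂, m₂, -, ez₂, et₂, -⟩ := exists_matching_triangle_s4 hT hvz hvt (Ne.symm htz)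
  have h₁ := hg' v₁ y₁ v' y' n₁ hvy' (ey₁.trans ey'.symm) (by rwa [ey₁, ey])
  have h₂ := hg' v₂ z₂ v' z' n₂ hvz' (ez₂.trans ez'.symm) (by rwa [ez₂, ez])
  rw [Sym2.eq_iff] at h₁ h₂
  rcases h₁ with ⟨rfl, rfl⟩ | ⟨rfl, rfl⟩
  · exact ⟨t₁, m₁, et₁.trans et⟩
  rcases h₂ with ⟨rfl, rfl⟩ | ⟨rfl, rfl⟩
  · exact ⟨t₂, m₂, et₂.trans et⟩
  -- In the remaining case the edges of weights `a`, `b`, `d` form a triangle in `g'`.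
  exfalso
  have h₃ := hg' _ _ _ _ m₁ m₂ (et₁.trans et₂.symm) (by rwa [et₁, et])
  rw [Sym2.eq_iff] at h₃
  have hyz₁ : g' s(v₁, v₂) = d := by
    rcases h₃ with ⟨h, -⟩ | ⟨-, h⟩
    · exact absurd h hyz'
    · rw [← h, et₁, et]
  obtain ⟨p, q, r, npq, npr, nqr, epq, epr, eqr, -⟩ :=
    exists_matching_triangle_s4 hT.symm hvy' hvz' hyz'
  rw [ey'] at epq
  rw [ez'] at epr
  rw [hyz₁] at eqr
  have k₁ := hg p q v y npq hvy epq (by rwa [epq, ey])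
  have k₂ := hg p r v z npr hvz epr (by rwa [epr, ez])
  have k₃ := hg q r v t nqr hvt (eqr.trans et.symm) (by rwa [eqr])
  simp only [Sym2.eq_iff] at k₁ k₂ k₃
  grind

/-- The weight of a node together with the nonzero weights of the edges at it. -/
def nodeProfile (g : Sym2 (Fin n) → X) (v : Fin n) : X × Set X :=
  (g s(v, v), incidentWeights g v)

theorem exists_nodeProfile_eq {g g' : Sym2 (Fin n) → X} (hg : DistinctEdgeWeights g)
    (hg' : DistinctEdgeWeights g') (hT : triangleDist g' = triangleDist g) {v : Fin n}
    (hv : (incidentWeights g v).Nontrivial) : ∃ v', nodeProfile g' v' = nodeProfile g v := by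
  obtain ⟨a, ha, b, hb, hab⟩ := hv
  obtain ⟨v', hw, hsub⟩ := exists_matching_node hg hg' hT hab ha hb
  obtain ⟨v'', -, hsub'⟩ := exists_matching_node hg' hg hT.symm hab (hsub ha) (hsub hb)
  obtain rfl := hg.eq_of_mem_of_mem hab ha hb (hsub' (hsub ha)) (hsub' (hsub hb))
  exact ⟨v', Prod.ext hw (hsub'.antisymm hsub)⟩

/-- If the nodes of two graphs with distinct edge weights can be matched so that the profiles
agree, then the graphs are isomorphic. -/
theorem graphIso_of_nodeProfile {g g' : Sym2 (Fin n) → X} (hg : DistinctEdgeWeights g)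
    (hg' : DistinctEdgeWeights g') (π : Equiv.Perm (Fin n))
    (hπ : ∀ v, nodeProfile g (π v) = nodeProfile g' v) : GraphIso g g' := by
  have edge : ∀ {h : Sym2 (Fin n) → X}, DistinctEdgeWeights h → ∀ {u v : Fin n} {a : X}, u ≠ v →
      a ∈ incidentWeights h u → a ∈ incidentWeights h v → h s(u, v) = a := by
    rintro h hh u v a huv ⟨ha, y, hy, ey⟩ ⟨-, z, hz, ez⟩
    have := hh u y v z hy hz (ey.trans ez.symm) (ey ▸ ha)
    rw [Sym2.eq_iff] at this
    grind
  have mem : ∀ (h : Sym2 (Fin n) → X) {u v : Fin n}, u ≠ v → h s(u, v) ≠ 0 →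
      h s(u, v) ∈ incidentWeights h u ∧ h s(u, v) ∈ incidentWeights h v :=
    fun h u v huv h0 => ⟨⟨h0, v, huv, rfl⟩, ⟨h0, u, huv.symm, congrArg h Sym2.eq_swap⟩⟩
  have hw : ∀ v, g s(π v, π v) = g' s(v, v) := fun v => congrArg Prod.fst (hπ v)
  have hE : ∀ v, incidentWeights g (π v) = incidentWeights g' v := fun v => congrArg Prod.snd (hπ v)
  refine ⟨π, fun i j => ?_⟩
  rcases eq_or_ne i j with rfl | hij
  · exact (hw i).symm
  have hπij : π i ≠ π j := π.injective.ne hij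
  by_cases h0 : g' s(i, j) = 0
  · by_contra hne
    obtain ⟨h₁, h₂⟩ := mem g hπij fun h => hne (h0.trans h.symm)
    exact hne (edge hg' hij (hE i ▸ h₁) (hE j ▸ h₂))
  · obtain ⟨h₁, h₂⟩ := mem g' hij h0
    exact (edge hg hπij ((hE i).symm ▸ h₁) ((hE j).symm ▸ h₂)).symm

open Classical in
theorem count_nodeProfile_le {g g' : Sym2 (Fin n) → X} (hg : DistinctEdgeWeights g)
    (hg' : DistinctEdgeWeights g') (hT : triangleDist g' = triangleDist g) (x : X) {A : Set X}
    (hA : A.Nontrivial) :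
    (Finset.univ.val.map (nodeProfile g)).count (x, A) ≤
      (Finset.univ.val.map (nodeProfile g')).count (x, A) := by
  by_cases hmem : (x, A) ∈ Finset.univ.val.map (nodeProfile g)
  · obtain ⟨v, -, hv⟩ := Multiset.mem_map.1 hmem
    have hvA : incidentWeights g v = A := congrArg Prod.snd hv
    obtain ⟨v', hv'⟩ := exists_nodeProfile_eq hg hg' hT (hvA.symm ▸ hA)
    have hle : (Finset.univ.val.map (nodeProfile g)).count (x, A) ≤ 1 := by
      rw [Multiset.count_map]
      change (Finset.univ.filter fun u => (x, A) = nodeProfile g u).card ≤ 1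
      refine Finset.card_le_one.2 fun u hu u' hu' => ?_
      obtain ⟨a, ha, b, hb, hab⟩ := hA
      have e : A = incidentWeights g u := congrArg Prod.snd (Finset.mem_filter.1 hu).2
      have e' : A = incidentWeights g u' := congrArg Prod.snd (Finset.mem_filter.1 hu').2
      exact hg.eq_of_mem_of_mem hab (e ▸ ha) (e ▸ hb) (e' ▸ ha) (e' ▸ hb)
    exact hle.trans (Multiset.one_le_count_iff_mem.2
      (Multiset.mem_map.2 ⟨v', Finset.mem_univ_val _, hv'.trans hv⟩))
  · rw [Multiset.count_eq_zero_of_notMem hmem]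
    exact Nat.zero_le _

open Classical in
theorem map_fst_filter_nodeProfile (hn : 3 ≤ n) {g g' : Sym2 (Fin n) → X}
    (hg : DistinctEdgeWeights g) (hg' : DistinctEdgeWeights g')
    (hT : triangleDist g' = triangleDist g) (a : X) :
    ((Finset.univ.val.map (nodeProfile g')).filter fun p => a ∈ p.2).map Prod.fst =
      ((Finset.univ.val.map (nodeProfile g)).filter fun p => a ∈ p.2).map Prod.fst := by
  have third : ∀ u v : Fin n, u ≠ v → ∃ w, u ≠ w ∧ v ≠ w := by
    intro u v huv
    obtain ⟨w, hw⟩ := Finset.exists_mem_notMem_of_card_lt_card (s := {u, v}) (t := Finset.univ)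
      (by rw [Finset.card_pair huv, Finset.card_univ, Fintype.card_fin]; omega)
    simp only [Finset.mem_univ, Finset.mem_insert, Finset.mem_singleton, true_and, not_or] at hw
    exact ⟨w, Ne.symm hw.1, Ne.symm hw.2⟩
  have ends : ∀ {h : Sym2 (Fin n) → X}, DistinctEdgeWeights h → ∀ {u v : Fin n}, u ≠ v → a ≠ 0 →
      h s(u, v) = a → ((Finset.univ.val.map (nodeProfile h)).filter fun p => a ∈ p.2).map Prod.fst =
        {h s(u, u), h s(v, v)} := by
    intro h hh u v huv ha e
    rw [Multiset.filter_map, Multiset.map_map]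
    have : Finset.univ.filter (fun w => a ∈ incidentWeights h w) = {u, v} := by
      ext w
      simp only [Finset.mem_filter, Finset.mem_univ, true_and, Finset.mem_insert,
        Finset.mem_singleton]
      constructor
      · rintro ⟨-, y, hy, ey⟩
        have := hh w y u v hy huv (ey.trans e.symm) (ey ▸ ha)
        rw [Sym2.eq_iff] at this
        tauto
      · rintro (rfl | rfl)
        · exact ⟨ha, v, huv, e⟩
        · exact ⟨ha, u, huv.symm, by rw [Sym2.eq_swap, e]⟩
    change (Finset.univ.filter fun w => a ∈ incidentWeights h w).val.map (fun w => h s(w, w)) = _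
    rw [this, Finset.insert_val_of_notMem (by simpa using huv)]
    rfl
  have empty : ∀ {h : Sym2 (Fin n) → X}, (∀ v, a ∉ incidentWeights h v) →
      ((Finset.univ.val.map (nodeProfile h)).filter fun p => a ∈ p.2).map Prod.fst = 0 := by
    intro h hh
    rw [Multiset.map_eq_zero, Multiset.filter_eq_nil]
    intro p hp
    obtain ⟨v, -, rfl⟩ := Multiset.mem_map.1 hp
    exact hh v
  by_cases hex : ∃ v, a ∈ incidentWeights g v
  · obtain ⟨u, ha, v, huv, e⟩ := hex
    obtain ⟨w, huw, hvw⟩ := third u v huv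
    obtain ⟨i, j, k, hij, -, -, e', -, -, hi, hj, -⟩ := exists_matching_triangle_s4 hT huv huw hvw
    rw [ends hg huv ha e, ends hg' hij ha (e'.trans e), hi, hj]
  · push Not at hex
    rw [empty hex, empty]
    rintro u ⟨ha, v, huv, e⟩
    obtain ⟨w, huw, hvw⟩ := third u v huv
    obtain ⟨i, j, k, hij, -, -, e', -⟩ := exists_matching_triangle_s4 hT.symm huv huw hvw
    exact hex i ⟨ha, j, hij, e'.trans e⟩

end Reconstruction

open Classical in
/-- Two multisets of pairs agree at second component `y₀` if they agree at all other second
components satisfying `q` and have the same first components among the pairs satisfying `q`. -/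
theorem Multiset.count_eq_of_map_fst_filter_eq {α β : Type*} {P Q : Multiset (α × β)}
    (q : β → Prop) [DecidablePred q] {y₀ : β} (hy₀ : q y₀)
    (hfst : (P.filter fun p => q p.2).map Prod.fst = (Q.filter fun p => q p.2).map Prod.fst)
    (hcount : ∀ x y, q y → y ≠ y₀ → P.count (x, y) = Q.count (x, y)) (x : α) :
    P.count (x, y₀) = Q.count (x, y₀) := by
  have split : ∀ R : Multiset (α × β), R.filter (fun p => q p.2) =
      R.filter (fun p => p.2 = y₀) + R.filter (fun p => q p.2 ∧ p.2 ≠ y₀) := by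
    intro R
    ext p
    simp only [Multiset.count_add, Multiset.count_filter]
    by_cases h : p.2 = y₀ <;> simp [h, hy₀]
  have hrest : P.filter (fun p => q p.2 ∧ p.2 ≠ y₀) = Q.filter (fun p => q p.2 ∧ p.2 ≠ y₀) := by
    ext ⟨x, y⟩
    simp only [Multiset.count_filter]
    split_ifs with h
    · exact hcount x y h.1 h.2
    · rfl
  rw [split P, split Q, hrest, Multiset.map_add, Multiset.map_add, add_left_inj] at hfst
  have fiber : ∀ R : Multiset (α × β),
      R.count (x, y₀) = ((R.filter fun p => p.2 = y₀).map Prod.fst).count x := by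
    intro R
    rw [Multiset.count_map, Multiset.filter_filter, Multiset.count_eq_card_filter_eq]
    congr 1
    exact Multiset.filter_congr fun p _ => by grind
  rw [fiber, fiber, hfst]

open Classical in
theorem exists_perm_of_map_univ_eq {α β : Type*} [Fintype α] {f f' : α → β}
    (h : Finset.univ.val.map f' = Finset.univ.val.map f) :
    ∃ π : Equiv.Perm α, ∀ v, f (π v) = f' v := by
  have hcard : ∀ c, Fintype.card {v // f' v = c} = Fintype.card {v // f v = c} := by
    intro c
    have := congrArg (Multiset.count c) h
    rw [Multiset.count_map, Multiset.count_map] at this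
    simp only [Fintype.card_subtype, eq_comm (b := c)]
    exact this
  exact ⟨Equiv.ofFiberEquiv fun c => Fintype.equivOfCardEq (hcard c),
    fun v => Equiv.ofFiberEquiv_map _ v⟩

/-- Corollary: if `0` is the only edge weight between distinct nodes that may
occur repeatedly, then `G` is reconstructible from the distribution of its
subtriangles. -/
theorem reconstructible_of_distinct_weights {n : ℕ} {X : Type*} [Zero X]
    (hn : 3 ≤ n) (g : Sym2 (Fin n) → X)
    (hyp : ∀ i j k l : Fin n, i ≠ j → k ≠ l →
      g s(i, j) = g s(k, l) → g s(i, j) ≠ 0 → s(i, j) = s(k, l)) :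
    ∀ g' : Sym2 (Fin n) → X, triangleDist g' = triangleDist g →
      GraphIso g g' := by
  classical
  intro g' hT
  have hg : DistinctEdgeWeights g := hyp
  have hg' : DistinctEdgeWeights g' := hg.of_triangleDist_eq hn hT
  suffices h : Finset.univ.val.map (nodeProfile g') = Finset.univ.val.map (nodeProfile g) by
    obtain ⟨π, hπ⟩ := exists_perm_of_map_univ_eq h
    exact graphIso_of_nodeProfile hg hg' π hπ
  have hnontrivial : ∀ x (A : Set X), A.Nontrivial →
      (Finset.univ.val.map (nodeProfile g')).count (x, A) =
        (Finset.univ.val.map (nodeProfile g)).count (x, A) := fun x A hA =>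
    (count_nodeProfile_le hg' hg hT.symm x hA).antisymm (count_nodeProfile_le hg hg' hT x hA)
  have hnonempty : ∀ x (A : Set X), A.Nonempty →
      (Finset.univ.val.map (nodeProfile g')).count (x, A) =
        (Finset.univ.val.map (nodeProfile g)).count (x, A) := by
    intro x A hA
    rcases hA.exists_eq_singleton_or_nontrivial with ⟨a, rfl⟩ | hA
    · refine Multiset.count_eq_of_map_fst_filter_eq (fun A => a ∈ A) rfl
        (map_fst_filter_nodeProfile hn hg hg' hT a) (fun x A ha hne => ?_) x
      exact hnontrivial x A ((Set.nontrivial_iff_ne_singleton ha).2 hne)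
    · exact hnontrivial x A hA
  ext ⟨x, A⟩
  rcases A.eq_empty_or_nonempty with rfl | hA
  · refine Multiset.count_eq_of_map_fst_filter_eq (fun _ => True) trivial ?_
      (fun x A _ hne => hnonempty x A (Set.nonempty_iff_ne_empty.2 hne)) x
    rw [Multiset.filter_true, Multiset.filter_true, Multiset.map_map, Multiset.map_map]
    ext y
    rw [Multiset.count_map, Multiset.count_map]
    have := card_nodes_eq_of_triangleDist_eq hn hT y
    simp only [eq_comm (b := y)] at this
    exact this
  · exact hnonempty x A hA
end
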